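/- Let $w_-<w_m$, let $w_0$ be the tanh profile, and let $w(t,x)=w_0(\Phi_t^{-1}(x))$ be the Burgers solution. Then for every $t\ge 0$ and $x\in\mathbb{R}$, writing $y=\Phi_t^{-1}(x)$, the second spatial derivative exists and equals $\partial_x^2 w(t,x)=\frac{w_0''(y)}{(1+t\,w_0'(y))^3}$, and it satisfies $|\partial_x^2 w(t,x)|\le 2\,\partial_x w(t,x)$. -/

import Mathlib

/-- The tanh profile `w₀(x) = (w_m + w_-)/2 + (w_m - w_-)/2 * tanh x`. -/
noncomputable def tanhProfile (wminus wm : ℝ) (x : ℝ) : ℝ :=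
  (wm + wminus) / 2 + (wm - wminus) / 2 * Real.tanh x

/-- The characteristic map `Φ_t(y) = y + t w₀(y)`. -/
noncomputable def charMap (wminus wm t : ℝ) (y : ℝ) : ℝ :=
  y + t * tanhProfile wminus wm y

/-- The Burgers solution `w(t,x) = w₀(Φ_t⁻¹(x))`. -/
noncomputable def burgersSol (wminus wm : ℝ) (t x : ℝ) : ℝ :=
  tanhProfile wminus wm (Function.invFun (charMap wminus wm t) x)

open Filter Function Topology

theorem Real.hasDerivAt_tanh (y : ℝ) : HasDerivAt Real.tanh (1 - Real.tanh y ^ 2) y := by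
  have hc : Real.cosh y ≠ 0 := (Real.cosh_pos y).ne'
  have hd := (Real.hasDerivAt_sinh y).div (Real.hasDerivAt_cosh y) hc
  have he : Real.tanh = Real.sinh / Real.cosh := funext Real.tanh_eq_sinh_div_cosh
  rw [he]
  refine hd.congr_deriv ?_
  simp only [Pi.div_apply]
  field_simp

section Profile

variable (wminus wm : ℝ)

theorem hasDerivAt_tanhProfile (y : ℝ) :
    HasDerivAt (tanhProfile wminus wm) ((wm - wminus) / 2 * (1 - Real.tanh y ^ 2)) y :=
  ((Real.hasDerivAt_tanh y).const_mul ((wm - wminus) / 2)).const_add ((wm + wminus) / 2)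

theorem deriv_tanhProfile :
    deriv (tanhProfile wminus wm) = fun y => (wm - wminus) / 2 * (1 - Real.tanh y ^ 2) :=
  funext fun y => (hasDerivAt_tanhProfile wminus wm y).deriv

theorem hasDerivAt_deriv_tanhProfile (y : ℝ) :
    HasDerivAt (deriv (tanhProfile wminus wm))
      (-2 * Real.tanh y * deriv (tanhProfile wminus wm) y) y := by
  rw [deriv_tanhProfile]
  refine ((((Real.hasDerivAt_tanh y).pow 2).const_sub 1).const_mul
    ((wm - wminus) / 2)).congr_deriv ?_
  push_cast
  ring

theorem iteratedDeriv_two_tanhProfile (y : ℝ) :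
    iteratedDeriv 2 (tanhProfile wminus wm) y =
      -2 * Real.tanh y * deriv (tanhProfile wminus wm) y := by
  rw [iteratedDeriv_succ, iteratedDeriv_one, (hasDerivAt_deriv_tanhProfile wminus wm y).deriv]

theorem hasDerivAt_charMap (t y : ℝ) :
    HasDerivAt (charMap wminus wm t) (1 + t * deriv (tanhProfile wminus wm) y) y :=
  (hasDerivAt_id y).add
    ((hasDerivAt_tanhProfile wminus wm y).differentiableAt.hasDerivAt.const_mul t)

theorem exists_abs_charMap_sub_le (t : ℝ) :
    ∃ C, ∀ y, |charMap wminus wm t y - y| ≤ C := by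
  refine ⟨|t| * (|(wm + wminus) / 2| + |(wm - wminus) / 2|), fun y => ?_⟩
  rw [charMap, add_sub_cancel_left, abs_mul, tanhProfile]
  gcongr
  refine (abs_add_le _ _).trans (add_le_add_right ?_ _)
  rw [abs_mul]
  exact mul_le_of_le_one_right (abs_nonneg _) (Real.abs_tanh_lt_one y).le

theorem charMap_surjective (t : ℝ) : Surjective (charMap wminus wm t) := by
  obtain ⟨C, hC⟩ := exists_abs_charMap_sub_le wminus wm t
  have hcont : Continuous (charMap wminus wm t) :=
    continuous_iff_continuousAt.2 fun y => (hasDerivAt_charMap wminus wm t y).continuousAt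
  refine hcont.surjective ?_ ?_
  · refine tendsto_atTop_mono (fun y => ?_) (tendsto_atTop_add_const_right _ (-C) tendsto_id)
    have := (abs_le.1 (hC y)).1
    simp only [id]
    linarith
  · refine tendsto_atBot_mono (fun y => ?_) (tendsto_atBot_add_const_right _ C tendsto_id)
    have := (abs_le.1 (hC y)).2
    simp only [id]
    linarith

variable {wminus wm}

theorem deriv_tanhProfile_pos (h : wminus < wm) (y : ℝ) :
    0 < deriv (tanhProfile wminus wm) y := by
  rw [deriv_tanhProfile]
  exact mul_pos (by linarith) (sub_pos.2 (Real.tanh_sq_lt_one y))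

theorem one_le_deriv_charMap (h : wminus < wm) {t : ℝ} (ht : 0 ≤ t) (y : ℝ) :
    1 ≤ 1 + t * deriv (tanhProfile wminus wm) y :=
  le_add_of_nonneg_right (mul_nonneg ht (deriv_tanhProfile_pos h y).le)

theorem charMap_strictMono (h : wminus < wm) {t : ℝ} (ht : 0 ≤ t) :
    StrictMono (charMap wminus wm t) :=
  strictMono_of_deriv_pos fun y => by
    rw [(hasDerivAt_charMap wminus wm t y).deriv]
    exact zero_lt_one.trans_le (one_le_deriv_charMap h ht y)

theorem hasDerivAt_invFun_charMap (h : wminus < wm) {t : ℝ} (ht : 0 ≤ t) (x : ℝ) :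
    HasDerivAt (invFun (charMap wminus wm t))
      (1 + t * deriv (tanhProfile wminus wm) (invFun (charMap wminus wm t) x))⁻¹ x := by
  have hmono := charMap_strictMono h ht
  have hright : RightInverse (invFun (charMap wminus wm t)) (charMap wminus wm t) :=
    rightInverse_invFun (charMap_surjective wminus wm t)
  have hinv : Monotone (invFun (charMap wminus wm t)) := fun a b hab => by
    rwa [← hmono.le_iff_le, hright a, hright b]
  exact HasDerivAt.of_local_left_inverse
    (hinv.continuous_of_surjective (invFun_surjective hmono.injective)).continuousAt
    (hasDerivAt_charMap wminus wm t _)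
    (zero_lt_one.trans_le (one_le_deriv_charMap h ht _)).ne' (Eventually.of_forall hright)

theorem deriv_burgersSol (h : wminus < wm) {t : ℝ} (ht : 0 ≤ t) :
    deriv (burgersSol wminus wm t) = fun x =>
      deriv (tanhProfile wminus wm) (invFun (charMap wminus wm t) x) /
        (1 + t * deriv (tanhProfile wminus wm) (invFun (charMap wminus wm t) x)) :=
  funext fun x => ((hasDerivAt_tanhProfile wminus wm _).differentiableAt.hasDerivAt.comp x
    (hasDerivAt_invFun_charMap h ht x)).deriv

theorem hasDerivAt_deriv_burgersSol (h : wminus < wm) {t : ℝ} (ht : 0 ≤ t) (x : ℝ) :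
    HasDerivAt (deriv (burgersSol wminus wm t))
      (iteratedDeriv 2 (tanhProfile wminus wm) (invFun (charMap wminus wm t) x) /
        (1 + t * deriv (tanhProfile wminus wm) (invFun (charMap wminus wm t) x)) ^ 3) x := by
  have hne := (zero_lt_one.trans_le
    (one_le_deriv_charMap h ht (invFun (charMap wminus wm t) x))).ne'
  have hcomp := (hasDerivAt_deriv_tanhProfile wminus wm _).comp x
    (hasDerivAt_invFun_charMap h ht x)
  rw [deriv_burgersSol h ht, iteratedDeriv_two_tanhProfile]
  refine (hcomp.div ((hcomp.const_mul t).const_add 1) hne).congr_deriv ?_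
  simp only [comp_apply]
  field_simp
  ring

end Profile

/-- For every `t ≥ 0` and `x`, with `y = Φ_t⁻¹(x)`, the second spatial derivative of the
Burgers solution exists and equals `w₀''(y)/(1 + t w₀'(y))³`, and
`|∂ₓ²w(t,x)| ≤ 2 ∂ₓw(t,x)`. -/
theorem stmt_7 (wminus wm : ℝ) (h : wminus < wm) (t : ℝ) (ht : 0 ≤ t) (x : ℝ) :
    HasDerivAt (deriv (fun ξ => burgersSol wminus wm t ξ))
        (iteratedDeriv 2 (tanhProfile wminus wm) (Function.invFun (charMap wminus wm t) x)
          / (1 + t * deriv (tanhProfile wminus wm)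
              (Function.invFun (charMap wminus wm t) x)) ^ 3)
        x ∧
      |deriv (deriv (fun ξ => burgersSol wminus wm t ξ)) x| ≤
        2 * deriv (fun ξ => burgersSol wminus wm t ξ) x := by
  have hd := hasDerivAt_deriv_burgersSol h ht x
  refine ⟨hd, ?_⟩
  change |deriv (deriv (burgersSol wminus wm t)) x| ≤ 2 * deriv (burgersSol wminus wm t) x
  rw [hd.deriv, deriv_burgersSol h ht, iteratedDeriv_two_tanhProfile]
  set y := invFun (charMap wminus wm t) x
  have hp := deriv_tanhProfile_pos h y
  have hJ := one_le_deriv_charMap h ht y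
  have hJ0 := zero_lt_one.trans_le hJ
  rw [abs_div, abs_of_pos (pow_pos hJ0 3), abs_mul, abs_of_pos hp, abs_mul, abs_neg, abs_two,
    ← mul_div_assoc]
  gcongr
  · exact mul_le_of_le_one_right zero_le_two (Real.abs_tanh_lt_one y).le
  · exact le_self_pow₀ hJ three_ne_zero
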